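/- Let F be a field of characteristic 0 and A a unital F-algebra (not necessarily associative). Suppose c, d, e ∈ N_alt(A) satisfy [c,d] = [c,e] = [d,e] = 0 in A, and the derivations D_{c,d}, D_{c,e}, D_{d,e} are identically zero as operators on A. Then the operators L_c, L_d, L_e pairwise commute, and for all k, l, m ≥ 0, writing w = L_c^k L_d^l L_e^m(1) (the left-tapped monomial c^k d^l e^m), one has L_w = L_c^k L_d^l L_e^m as operators on A. -/

import Mathlib

/-- The associator `(x,y,z) = (xy)z - x(yz)`. -/
def assocEl {A : Type*} [NonUnitalNonAssocRing A] (x y z : A) : A :=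
  x * y * z - x * (y * z)

/-- The generalized alternative nucleus
`N_alt(A) = { s | (s,x,y) = -(x,s,y) = (x,y,s) for all x, y }`. -/
def Nalt (A : Type*) [NonUnitalNonAssocRing A] : Set A :=
  {s | ∀ x y : A, assocEl s x y = - assocEl x s y ∧ assocEl x s y = - assocEl x y s}

/-- The commutator of two linear operators. -/
def opComm {F A : Type*} [Field F] [AddCommGroup A] [Module F A]
    (f g : Module.End F A) : Module.End F A := f * g - g * f

/-- `D_{s,t} = [L_s,L_t] + [L_s,R_t] + [R_s,R_t]`. -/
def Dop (F : Type*) {A : Type*} [Field F]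
    [NonUnitalNonAssocRing A] [Module F A] [SMulCommClass F A A] [IsScalarTower F A A]
    (s t : A) : Module.End F A :=
  opComm (LinearMap.mulLeft F s) (LinearMap.mulLeft F t)
    + opComm (LinearMap.mulLeft F s) (LinearMap.mulRight F t)
    + opComm (LinearMap.mulRight F s) (LinearMap.mulRight F t)

section NaltLemmas

variable {F A : Type*} [Field F] [NonAssocRing A] [Module F A]
  [SMulCommClass F A A] [IsScalarTower F A A]

theorem assocEl_eq_zero_of_Dop_eq_zero [CharZero F] {s t : A} (hs : s ∈ Nalt A) (ht : t ∈ Nalt A)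
    (hst : s * t = t * s) (hD : Dop F s t = 0) (y : A) : assocEl s t y = 0 := by
  have h := LinearMap.congr_fun hD y
  simp only [Dop, opComm, LinearMap.add_apply, LinearMap.sub_apply, Module.End.mul_apply,
    LinearMap.mulLeft_apply, LinearMap.mulRight_apply, LinearMap.zero_apply] at h
  have hst_y : s * t * y = t * s * y := by rw [hst]
  have hy_st : y * (s * t) = y * (t * s) := by rw [hst]
  have key : (3 : F) • assocEl s t y = 0 := by
    obtain ⟨h₁, h₂⟩ := hs y t
    obtain ⟨h₃, h₄⟩ := ht s y
    have h₅ := (hs t y).1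
    have h₆ := (ht y s).1
    simp only [assocEl] at *
    rw [show (3 : F) = 1 + 1 + 1 by norm_num]
    simp only [add_smul, one_smul]
    grind
  exact (smul_eq_zero.mp key).resolve_left three_ne_zero

/-- For `s ∈ N_alt(A)` one has `L_{sx} = L_s L_x + [R_s, L_x]`; here the commutator vanishes. -/
theorem mulLeft_mul_of_mem_Nalt {s x : A} (hs : s ∈ Nalt A)
    (h : Commute (LinearMap.mulRight F s) (LinearMap.mulLeft F x)) :
    LinearMap.mulLeft F (s * x) = LinearMap.mulLeft F s * LinearMap.mulLeft F x := by
  ext y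
  have h₁ := (hs x y).1
  have h₂ := (hs x y).2
  have h₃ := LinearMap.congr_fun h.eq y
  simp only [assocEl, Module.End.mul_apply, LinearMap.mulLeft_apply,
    LinearMap.mulRight_apply] at *
  grind

theorem commute_mulRight_mulLeft_of_Dop_eq_zero [CharZero F] {s t : A}
    (hs : s ∈ Nalt A) (ht : t ∈ Nalt A) (hst : s * t = t * s) (hD : Dop F s t = 0) :
    Commute (LinearMap.mulRight F s) (LinearMap.mulLeft F t) := by
  ext y
  have h := assocEl_eq_zero_of_Dop_eq_zero hs ht hst hD y
  have h₁ := (hs t y).1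
  have h₂ := (hs t y).2
  simp only [assocEl, Module.End.mul_apply, LinearMap.mulLeft_apply,
    LinearMap.mulRight_apply] at *
  grind

theorem commute_mulRight_mulLeft_self [CharZero F] {s : A} (hs : s ∈ Nalt A) :
    Commute (LinearMap.mulRight F s) (LinearMap.mulLeft F s) := by
  ext y
  have key : (2 : F) • assocEl s y s = 0 := by
    have h₁ := hs s y
    have h₂ := hs y s
    rw [two_smul]
    grind
  have h := (smul_eq_zero.mp key).resolve_left two_ne_zero
  simpa [assocEl, sub_eq_zero] using h

theorem commute_mulLeft_of_Dop_eq_zero [CharZero F] {s t : A} (hs : s ∈ Nalt A) (ht : t ∈ Nalt A)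
    (hst : s * t = t * s) (hD : Dop F s t = 0) :
    Commute (LinearMap.mulLeft F s) (LinearMap.mulLeft F t) := by
  ext y
  have h := assocEl_eq_zero_of_Dop_eq_zero hs ht hst hD y
  have h₁ := (hs t y).1
  have hst_y : s * t * y = t * s * y := by rw [hst]
  simp only [assocEl, Module.End.mul_apply, LinearMap.mulLeft_apply] at *
  grind

theorem mulLeft_pow_mul_apply_one {s : A} (hs : s ∈ Nalt A)
    (hss : Commute (LinearMap.mulRight F s) (LinearMap.mulLeft F s)) {T : Module.End F A}
    (hsT : Commute (LinearMap.mulRight F s) T) (hT : LinearMap.mulLeft F (T 1) = T) (k : ℕ) :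
    LinearMap.mulLeft F ((LinearMap.mulLeft F s ^ k * T) 1) = LinearMap.mulLeft F s ^ k * T := by
  induction k with
  | zero => simpa using hT
  | succ k ih =>
    have hcomm := (hss.pow_right k).mul_right hsT
    rw [← ih] at hcomm
    rw [pow_succ', mul_assoc, Module.End.mul_apply, LinearMap.mulLeft_apply,
      mulLeft_mul_of_mem_Nalt hs hcomm, ih]

end NaltLemmas

/-- if `c, d, e ∈ N_alt(A)` commute pairwise in `A` and the
derivations `D_{c,d}, D_{c,e}, D_{d,e}` vanish identically, then `L_c, L_d, L_e`
pairwise commute and `L_{c^k d^l e^m} = L_c^k L_d^l L_e^m` for the left-tapped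
monomials `c^k d^l e^m = L_c^k L_d^l L_e^m (1)`. -/
theorem left_mul_of_cde_monomials
    (F A : Type*) [Field F] [CharZero F]
    [NonAssocRing A] [Module F A] [SMulCommClass F A A] [IsScalarTower F A A]
    (c d e : A) (hc : c ∈ Nalt A) (hd : d ∈ Nalt A) (he : e ∈ Nalt A)
    (hcd : c * d = d * c) (hce : c * e = e * c) (hde : d * e = e * d)
    (hDcd : Dop F c d = 0) (hDce : Dop F c e = 0) (hDde : Dop F d e = 0) :
    (LinearMap.mulLeft F c * LinearMap.mulLeft F d
      = LinearMap.mulLeft F d * LinearMap.mulLeft F c) ∧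
    (LinearMap.mulLeft F c * LinearMap.mulLeft F e
      = LinearMap.mulLeft F e * LinearMap.mulLeft F c) ∧
    (LinearMap.mulLeft F d * LinearMap.mulLeft F e
      = LinearMap.mulLeft F e * LinearMap.mulLeft F d) ∧
    (∀ k l m : ℕ,
      LinearMap.mulLeft F
          (((LinearMap.mulLeft F c) ^ k * (LinearMap.mulLeft F d) ^ l *
              (LinearMap.mulLeft F e) ^ m) (1 : A)) =
        (LinearMap.mulLeft F c) ^ k * (LinearMap.mulLeft F d) ^ l *
          (LinearMap.mulLeft F e) ^ m) := by
  have hcd' := commute_mulRight_mulLeft_of_Dop_eq_zero hc hd hcd hDcd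
  have hce' := commute_mulRight_mulLeft_of_Dop_eq_zero hc he hce hDce
  have hde' := commute_mulRight_mulLeft_of_Dop_eq_zero hd he hde hDde
  refine ⟨(commute_mulLeft_of_Dop_eq_zero hc hd hcd hDcd).eq,
    (commute_mulLeft_of_Dop_eq_zero hc he hce hDce).eq,
    (commute_mulLeft_of_Dop_eq_zero hd he hde hDde).eq, fun k l m ↦ ?_⟩
  have hm : LinearMap.mulLeft F ((LinearMap.mulLeft F e ^ m) 1) = LinearMap.mulLeft F e ^ m := by
    simpa using mulLeft_pow_mul_apply_one he (commute_mulRight_mulLeft_self he) (Commute.one_right _)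
      (by ext; simp) m
  rw [mul_assoc]
  exact mulLeft_pow_mul_apply_one hc (commute_mulRight_mulLeft_self hc)
    ((hcd'.pow_right l).mul_right (hce'.pow_right m))
    (mulLeft_pow_mul_apply_one hd (commute_mulRight_mulLeft_self hd) (hde'.pow_right m) hm l) k
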